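/- arXiv:math/0304041 — 7 statements merged into one kernel-verified Lean document; each statement's English description precedes it below -/
import Mathlib

section
/- Let k, n ≥ 1 and let V : {0,1,…,k}^n → ℝ. For every ordered collection of Boolean vectors x(1) ≥ x(2) ≥ … ≥ x(k) in {0,1}^n, setting j = Σ_{l=1}^k x(l) coordinatewise, one has the expansion V(j) = V(0) + Σ_{m=1}^n Σ_{1 ≤ l₁ < … < l_m ≤ n} Σ_{μ₁,…,μ_m = 1}^k Δ_{l₁,…,l_m} V(Σ_{κ=1}^m μ_κ e_{l_κ}) · ∏_{κ=1}^m x_{l_κ}(μ_κ), i.e. V, viewed through the decomposition of each integer coordinate as a sum of ordered Boolean variables, is given by the Boolean polynomial whose coefficients are the mixed difference derivatives of V at the indicated points. -/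
/-- The mixed difference derivative `Δ_{l₁,…,l_m} V(j)` over the set of indices
`S = {l₁,…,l_m}`.  The recursion
`Δ_{l₁,…,l_{m+1}} V(j) = Δ_{l₁,…,l_m} V(j) − Δ_{l₁,…,l_m} V(j − e_{l_{m+1}})`
(with `Δ_i V(j) = V(j) − V(j − e_i)`) unfolds to this inclusion–exclusion
closed form, which is symmetric in the indices. -/
noncomputable def mixedDiff {n : ℕ} (V : (Fin n → ℤ) → ℝ) (S : Finset (Fin n))
    (j : Fin n → ℤ) : ℝ :=
  ∑ T ∈ S.powerset, (-1 : ℝ) ^ T.card * V (fun i => j i - if i ∈ T then 1 else 0)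

open Finset in
/-- Abel summation against an antitone Boolean sequence: the weighted increments of `f` telescope
up to the number of `true` entries. -/
theorem sum_antitone_bool_mul_sub (z : ℕ → Bool) (f : ℤ → ℝ) (k : ℕ)
    (hz : ∀ l m : ℕ, 1 ≤ l → l ≤ m → m ≤ k → z m ≤ z l) :
    ∑ b ∈ Icc 1 k, (f b - f (b - 1)) * ((z b).toNat : ℝ) =
      f (∑ l ∈ Icc 1 k, ((z l).toNat : ℤ)) - f 0 := by
  induction k with
  | zero => simp
  | succ k ih =>
    have ih := ih fun l m h1 h2 h3 => hz l m h1 h2 (by omega)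
    rw [sum_Icc_succ_top (by omega), sum_Icc_succ_top (by omega), ih]
    cases h : z (k + 1) with
    | false => simp
    | true =>
      have hs : ∑ l ∈ Icc 1 k, ((z l).toNat : ℤ) = k := by
        rw [sum_congr rfl (g := fun _ => (1 : ℤ))]
        · simp
        · intro l hl
          rw [mem_Icc] at hl
          have := hz l (k + 1) hl.1 (by omega) le_rfl
          rw [h] at this
          simp [top_le_iff.mp this]
      rw [hs]
      simp

/-- Extension by zero of a tuple indexed by `S`. -/
def extendZero {n : ℕ} (S : Finset (Fin n)) (μ : ∀ i ∈ S, ℕ) (i : Fin n) : ℕ :=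
  if h : i ∈ S then μ i h else 0

theorem extendZero_cons {n : ℕ} (S : Finset (Fin n)) (a : Fin n) (b : ℕ) (μ : ∀ i ∈ S, ℕ) :
    extendZero (insert a S) (Finset.Pi.cons S a b μ) =
      Function.update (extendZero S μ) a b := by
  funext i
  by_cases hi : i = a
  · subst hi
    simp [extendZero]
  · by_cases hS : i ∈ S
    · simp [extendZero, hi, hS, Finset.Pi.cons_ne (Ne.symm hi)]
    · simp [extendZero, hi, hS]

theorem Finset.sum_pi_insert {ι M : Type*} {β : ι → Type*} [DecidableEq ι]
    [∀ i, DecidableEq (β i)] [AddCommMonoid M] {S : Finset ι} {a : ι} (ha : a ∉ S)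
    (t : ∀ i, Finset (β i)) (g : (∀ i ∈ insert a S, β i) → M) :
    ∑ μ ∈ (insert a S).pi t, g μ = ∑ b ∈ t a, ∑ μ ∈ S.pi t, g (Finset.Pi.cons S a b μ) := by
  rw [Finset.pi_insert ha, Finset.sum_biUnion]
  · exact Finset.sum_congr rfl fun b _ =>
      Finset.sum_image ((Finset.Pi.cons_injective ha).injOn)
  · intro b _ c _ hbc
    rw [Function.onFun, Finset.disjoint_left]
    intro μ hb hc
    obtain ⟨p, -, rfl⟩ := Finset.mem_image.mp hb
    obtain ⟨q, -, h⟩ := Finset.mem_image.mp hc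
    apply hbc
    have := congrFun (congrFun h a) (Finset.mem_insert_self a S)
    simpa using this.symm

theorem mixedDiff_insert {n : ℕ} (V : (Fin n → ℤ) → ℝ) {S : Finset (Fin n)} {a : Fin n}
    (ha : a ∉ S) (j : Fin n → ℤ) (b : ℤ) :
    mixedDiff V (insert a S) (Function.update j a b) =
      mixedDiff (fun j => V (Function.update j a b)) S j -
        mixedDiff (fun j => V (Function.update j a (b - 1))) S j := by
  unfold mixedDiff
  rw [Finset.sum_powerset_insert ha, sub_eq_add_neg, ← Finset.sum_neg_distrib]
  congr 1 <;> refine Finset.sum_congr rfl fun T hT => ?_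
  all_goals
    have haT : a ∉ T := fun h => ha (Finset.mem_powerset.mp hT h)
  · congr 2
    funext i
    by_cases hi : i = a
    · subst hi; simp [haT]
    · simp [hi]
  · rw [Finset.card_insert_of_notMem haT, pow_succ, mul_neg_one, neg_mul]
    congr 3
    funext i
    by_cases hi : i = a
    · subst hi; simp
    · simp [hi]

theorem sum_mixedDiff_insert {n : ℕ} (k : ℕ) (V : (Fin n → ℤ) → ℝ) {S : Finset (Fin n)}
    {a : Fin n} (ha : a ∉ S) (z : ℕ → Bool)
    (hz : ∀ l m : ℕ, 1 ≤ l → l ≤ m → m ≤ k → z m ≤ z l) (j : Fin n → ℤ) (hj : j a = 0) :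
    ∑ b ∈ Finset.Icc 1 k,
        mixedDiff V (insert a S) (Function.update j a (b : ℤ)) * ((z b).toNat : ℝ) =
      mixedDiff (fun j => V (Function.update j a (∑ l ∈ Finset.Icc 1 k, ((z l).toNat : ℤ)))) S j -
        mixedDiff V S j := by
  simp only [mixedDiff_insert V ha]
  rw [sum_antitone_bool_mul_sub z
    (fun b => mixedDiff (fun j => V (Function.update j a b)) S j) k hz]
  congr 1
  refine Finset.sum_congr rfl fun T hT => ?_
  have haT : a ∉ T := fun h => ha (Finset.mem_powerset.mp hT h)
  beta_reduce
  rw [Function.update_eq_self_iff.mpr]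
  simp [hj, haT]

/-- The part of the Boolean expansion of `V` that involves exactly the variables in `S`. -/
noncomputable def booleanTerm {n : ℕ} (k : ℕ) (x : ℕ → Fin n → Bool) (V : (Fin n → ℤ) → ℝ)
    (S : Finset (Fin n)) : ℝ :=
  ∑ μ ∈ S.pi (fun _ => Finset.Icc 1 k),
    mixedDiff V S (fun i => (extendZero S μ i : ℤ)) *
      ∏ i ∈ S, ((x (extendZero S μ i) i).toNat : ℝ)

theorem booleanTerm_insert {n : ℕ} (k : ℕ) (x : ℕ → Fin n → Bool) (V : (Fin n → ℤ) → ℝ)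
    (hord : ∀ l m : ℕ, 1 ≤ l → l ≤ m → m ≤ k → ∀ i, x m i ≤ x l i)
    {S : Finset (Fin n)} {a : Fin n} (ha : a ∉ S) :
    booleanTerm k x V (insert a S) =
      booleanTerm k x
        (fun j => V (Function.update j a (∑ l ∈ Finset.Icc 1 k, ((x l a).toNat : ℤ)))) S -
        booleanTerm k x V S := by
  unfold booleanTerm
  rw [Finset.sum_pi_insert ha, Finset.sum_comm, ← Finset.sum_sub_distrib]
  refine Finset.sum_congr rfl fun μ _ => ?_
  rw [← sub_mul, ← sum_mixedDiff_insert k V ha (fun l => x l a)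
    (fun l m h1 h2 h3 => hord l m h1 h2 h3 a) _ (by simp [extendZero, ha]), Finset.sum_mul]
  refine Finset.sum_congr rfl fun b _ => ?_
  rw [extendZero_cons, Finset.prod_insert ha, ← mul_assoc]
  congr 1
  · congr 2
    · funext i
      by_cases hi : i = a
      · subst hi; simp
      · simp [hi]
    · simp
  · refine Finset.prod_congr rfl fun i hi => ?_
    rw [Function.update_of_ne (ne_of_mem_of_not_mem hi ha)]

theorem eq_sum_booleanTerm {n : ℕ} (k : ℕ) (x : ℕ → Fin n → Bool)
    (hord : ∀ l m : ℕ, 1 ≤ l → l ≤ m → m ≤ k → ∀ i, x m i ≤ x l i)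
    (A : Finset (Fin n)) (V : (Fin n → ℤ) → ℝ) :
    V (fun i => if i ∈ A then ∑ l ∈ Finset.Icc 1 k, ((x l i).toNat : ℤ) else 0) =
      ∑ S ∈ A.powerset, booleanTerm k x V S := by
  induction A using Finset.induction_on generalizing V with
  | empty => simp [booleanTerm, mixedDiff, extendZero]
  | insert a A ha ih =>
    rw [Finset.sum_powerset_insert ha, ← Finset.sum_add_distrib]
    have hstep : ∀ S ∈ A.powerset,
        booleanTerm k x V S + booleanTerm k x V (insert a S) = booleanTerm k x
          (fun j => V (Function.update j a (∑ l ∈ Finset.Icc 1 k, ((x l a).toNat : ℤ)))) S := by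
      intro S hS
      rw [booleanTerm_insert k x V hord fun h => ha (Finset.mem_powerset.mp hS h)]
      ring
    rw [Finset.sum_congr rfl hstep, ← ih]
    congr 1
    funext i
    by_cases hi : i = a
    · subst hi; simp
    · simp [hi]

/-- expansion of `V` into a Boolean polynomial in the ordered Boolean
variables `x(1) ≥ x(2) ≥ … ≥ x(k)`, with coefficients the mixed difference
derivatives of `V`.  The inner sum over `1 ≤ l₁ < … < l_m ≤ n` together with the
outer sum over `m` is a sum over nonempty subsets `S` of `{1,…,n}`, and
`μ ∈ S.pi (Icc 1 k)` ranges over all tuples `(μ_κ)_{κ} ∈ {1,…,k}^S`. -/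
theorem boolean_polynomial_expansion (k n : ℕ) (hk : 1 ≤ k) (hn : 1 ≤ n)
    (V : (Fin n → ℤ) → ℝ)
    (x : ℕ → Fin n → Bool)
    (hord : ∀ l m : ℕ, 1 ≤ l → l ≤ m → m ≤ k → ∀ i, x m i ≤ x l i) :
    V (fun i => ∑ l ∈ Finset.Icc 1 k, ((x l i).toNat : ℤ)) =
      V (fun _ => 0) +
      ∑ S ∈ Finset.univ.powerset.filter (fun S : Finset (Fin n) => S.Nonempty),
        ∑ μ ∈ S.pi (fun _ => Finset.Icc 1 k),
          mixedDiff V S (fun i => if h : i ∈ S then ((μ i h : ℕ) : ℤ) else 0) *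
            ∏ i ∈ S.attach, ((x (μ i.1 i.2) i.1).toNat : ℝ) := by
  have h := eq_sum_booleanTerm k x hord Finset.univ V
  simp only [Finset.mem_univ, if_true] at h
  have hfilter : Finset.univ.powerset.filter (fun S : Finset (Fin n) => S.Nonempty) =
      Finset.univ.powerset.erase ∅ := by
    ext S
    simp [Finset.nonempty_iff_ne_empty]
  rw [h, hfilter, ← Finset.add_sum_erase _ _ (Finset.empty_mem_powerset Finset.univ)]
  congr 1
  · simp [booleanTerm, mixedDiff, extendZero]
  · refine Finset.sum_congr rfl fun S _ => Finset.sum_congr rfl fun μ _ => ?_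
    congr 1
    · congr 1
      funext i
      unfold extendZero
      split_ifs <;> simp
    · rw [← Finset.prod_attach]
      refine Finset.prod_congr rfl fun i _ => ?_
      simp [extendZero]
end

section
/- Let P : {0,1}^n → ℝ be submodular, D ⊆ {1,…,n}, and let x°, z° be Boolean vectors on D^c with x° ≤ z°. Let x'_D minimize x_D ↦ P(x_D, x°_{D^c}) and z'_D minimize x_D ↦ P(x_D, z°_{D^c}), and suppose x'_D ≤ z'_D fails, so that the set E = { i ∈ D : x'_i = 1 and z'_i = 0 } is nonempty. Then the vector (0_E, x'_{D∖E}) also minimizes x_D ↦ P(x_D, x°_{D^c}), the vector (1_E, z'_{D∖E}) also minimizes x_D ↦ P(x_D, z°_{D^c}), and (0_E, x'_{D∖E}) ≤ (1_E, z'_{D∖E}). -/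
/-- A function of Boolean vectors is submodular if
`f(x ∧ y) + f(x ∨ y) ≤ f(x) + f(y)` for all `x, y`. -/
def Submodular {n : ℕ} (f : (Fin n → Bool) → ℝ) : Prop :=
  ∀ x y : Fin n → Bool, f (x ⊓ y) + f (x ⊔ y) ≤ f x + f y

/-- `blend D x y` is the Boolean vector `(x_D, y_{D^c})`. -/
def blend {n : ℕ} (D : Finset (Fin n)) (x y : Fin n → Bool) : Fin n → Bool :=
  fun i => if i ∈ D then x i else y i

/-- Theorem 1 of the paper: with `x° ≤ z°` on `D^c`, minimizers
`x'_D` and `z'_D` for the two boundary vectors, and `x'_D ≤ z'_D` failing,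
the set `E = {i ∈ D | x'_i = 1, z'_i = 0}` is nonempty, `(0_E, x'_{D∖E})` also
minimizes `x_D ↦ P(x_D, x°_{D^c})`, `(1_E, z'_{D∖E})` also minimizes
`x_D ↦ P(x_D, z°_{D^c})`, and `(0_E, x'_{D∖E}) ≤ (1_E, z'_{D∖E})`. -/
theorem reordered_minimizers (n : ℕ) (P : (Fin n → Bool) → ℝ) (hP : Submodular P)
    (D : Finset (Fin n)) (x₀ z₀ : Fin n → Bool) (hxz : ∀ i ∉ D, x₀ i ≤ z₀ i)
    (x' z' : Fin n → Bool)
    (hx : ∀ x : Fin n → Bool, P (blend D x' x₀) ≤ P (blend D x x₀))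
    (hz : ∀ x : Fin n → Bool, P (blend D z' z₀) ≤ P (blend D x z₀))
    (hfail : ¬ ∀ i ∈ D, x' i ≤ z' i) :
    (D.filter (fun i => x' i = true ∧ z' i = false)).Nonempty ∧
    (∀ x : Fin n → Bool,
      P (blend D
          (fun i => if i ∈ D.filter (fun i => x' i = true ∧ z' i = false)
            then false else x' i) x₀) ≤ P (blend D x x₀)) ∧
    (∀ x : Fin n → Bool,
      P (blend D
          (fun i => if i ∈ D.filter (fun i => x' i = true ∧ z' i = false)
            then true else z' i) z₀) ≤ P (blend D x z₀)) ∧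
    (∀ i ∈ D,
      (if i ∈ D.filter (fun i => x' i = true ∧ z' i = false) then false else x' i) ≤
      (if i ∈ D.filter (fun i => x' i = true ∧ z' i = false) then true else z' i)) := by
  have hinf : blend D (fun i => if i ∈ D.filter (fun i => x' i = true ∧ z' i = false)
      then false else x' i) x₀ = blend D x' x₀ ⊓ blend D z' z₀ := by
    funext i
    have h := hxz i
    by_cases hi : i ∈ D
    · cases hx' : x' i <;> cases hz' : z' i <;> simp [blend, hi, hx', hz']
    · simpa [blend, hi, Bool.le_iff_imp] using h hi
  have hsup : blend D (fun i => if i ∈ D.filter (fun i => x' i = true ∧ z' i = false)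
      then true else z' i) z₀ = blend D x' x₀ ⊔ blend D z' z₀ := by
    funext i
    have h := hxz i
    by_cases hi : i ∈ D
    · cases hx' : x' i <;> cases hz' : z' i <;> simp [blend, hi, hx', hz']
    · simpa [blend, hi, Bool.le_iff_imp] using h hi
  have hsub := hP (blend D x' x₀) (blend D z' z₀)
  rw [← hinf, ← hsup] at hsub
  refine ⟨?_, fun x => ?_, fun x => ?_, fun i hi => ?_⟩
  · push Not at hfail
    obtain ⟨i, hi, hlt⟩ := hfail
    refine ⟨i, Finset.mem_filter.2 ⟨hi, ?_⟩⟩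
    rwa [Bool.lt_iff, and_comm] at hlt
  · refine le_trans ?_ (hx x)
    linarith [hz (fun i => if i ∈ D.filter (fun i => x' i = true ∧ z' i = false)
      then true else z' i)]
  · refine le_trans ?_ (hz x)
    linarith [hx (fun i => if i ∈ D.filter (fun i => x' i = true ∧ z' i = false)
      then false else x' i)]
  · cases hx' : x' i <;> cases hz' : z' i <;> simp [hi, hx', hz']
end

section
/- Let P : {0,1}^n → ℝ be submodular, D ⊆ {1,…,n}, and let x°, z° be Boolean vectors on D^c with x° ≤ z°. Then for every minimizer x'_D of x_D ↦ P(x_D, x°_{D^c}) over {0,1}^D there exists a minimizer z'_D of x_D ↦ P(x_D, z°_{D^c}) over {0,1}^D such that x'_D ≤ z'_D. -/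
/-- Corollary (i): for submodular `P` and boundary vectors
`x° ≤ z°` on `D^c`, every minimizer `x'_D` for boundary `x°` is dominated by
some minimizer `z'_D` for boundary `z°`. -/
theorem exists_dominating_minimizer (n : ℕ) (P : (Fin n → Bool) → ℝ)
    (hP : Submodular P) (D : Finset (Fin n)) (x₀ z₀ : Fin n → Bool)
    (hxz : ∀ i ∉ D, x₀ i ≤ z₀ i) (x' : Fin n → Bool)
    (hx : ∀ x : Fin n → Bool, P (blend D x' x₀) ≤ P (blend D x x₀)) :
    ∃ z' : Fin n → Bool,
      (∀ x : Fin n → Bool, P (blend D z' z₀) ≤ P (blend D x z₀)) ∧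
      ∀ i ∈ D, x' i ≤ z' i := by
  obtain ⟨z, hz⟩ := Finite.exists_min fun x => P (blend D x z₀)
  have h_inf : blend D x' x₀ ⊓ blend D z z₀ = blend D (x' ⊓ z) x₀ := by
    ext1 i
    by_cases hi : i ∈ D
    · simp [blend, hi]
    · simpa [blend, hi] using inf_eq_left.mpr (hxz i hi)
  have h_sup : blend D x' x₀ ⊔ blend D z z₀ = blend D (x' ⊔ z) z₀ := by
    ext1 i
    by_cases hi : i ∈ D
    · simp [blend, hi]
    · simpa [blend, hi] using sup_eq_right.mpr (hxz i hi)
  have h_sub := hP (blend D x' x₀) (blend D z z₀)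
  rw [h_inf, h_sup] at h_sub
  refine ⟨x' ⊔ z, fun x => ?_, fun i _ => le_sup_left (a := x') (b := z) i⟩
  linarith [hx (x' ⊓ z), hz x]
end

section
/- Let P : {0,1}^n → ℝ be submodular, D ⊆ {1,…,n}, and let x°, z° be Boolean vectors on D^c with x° ≤ z°. Then for every minimizer z'_D of x_D ↦ P(x_D, z°_{D^c}) over {0,1}^D there exists a minimizer x'_D of x_D ↦ P(x_D, x°_{D^c}) over {0,1}^D such that x'_D ≤ z'_D. -/
/-- Corollary (ii): for submodular `P` and boundary vectors
`x° ≤ z°` on `D^c`, every minimizer `z'_D` for boundary `z°` dominates some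
minimizer `x'_D` for boundary `x°`. -/
theorem exists_dominated_minimizer (n : ℕ) (P : (Fin n → Bool) → ℝ)
    (hP : Submodular P) (D : Finset (Fin n)) (x₀ z₀ : Fin n → Bool)
    (hxz : ∀ i ∉ D, x₀ i ≤ z₀ i) (z' : Fin n → Bool)
    (hz : ∀ x : Fin n → Bool, P (blend D z' z₀) ≤ P (blend D x z₀)) :
    ∃ x' : Fin n → Bool,
      (∀ x : Fin n → Bool, P (blend D x' x₀) ≤ P (blend D x x₀)) ∧
      ∀ i ∈ D, x' i ≤ z' i := by
  obtain ⟨w, hw⟩ := Finite.exists_min fun x : Fin n → Bool => P (blend D x x₀)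
  refine ⟨w ⊓ z', fun x => ?_, fun i _ => inf_le_right (a := w i)⟩
  have h_inf : blend D w x₀ ⊓ blend D z' z₀ = blend D (w ⊓ z') x₀ := by
    funext i
    by_cases hi : i ∈ D
    · simp [blend, hi]
    · simpa only [blend, hi, Pi.inf_apply, if_false] using inf_eq_left.2 (hxz i hi)
  have h_sup : blend D w x₀ ⊔ blend D z' z₀ = blend D (w ⊔ z') z₀ := by
    funext i
    by_cases hi : i ∈ D
    · simp [blend, hi]
    · simpa only [blend, hi, Pi.sup_apply, if_false] using sup_eq_right.2 (hxz i hi)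
  have h := hP (blend D w x₀) (blend D z' z₀)
  rw [h_inf, h_sup] at h
  linarith [hw x, hz (w ⊔ z')]
end

section
/- Let P : {0,1}^n → ℝ be submodular, D ⊆ {1,…,n}, and let x°, z° be Boolean vectors on D^c with x° ≤ z°. Let x̲', x̄' be the least and greatest elements of the set of minimizers of x_D ↦ P(x_D, x°_{D^c}), and z̲', z̄' the least and greatest elements of the set of minimizers of x_D ↦ P(x_D, z°_{D^c}). Then x̲' ≤ z̲' and x̄' ≤ z̄'. -/
theorem blend_inf_blend {n : ℕ} {D : Finset (Fin n)} {x₀ z₀ : Fin n → Bool}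
    (hxz : ∀ i ∉ D, x₀ i ≤ z₀ i) (x z : Fin n → Bool) :
    blend D x x₀ ⊓ blend D z z₀ = blend D (x ⊓ z) x₀ := by
  funext i
  by_cases hi : i ∈ D
  · simp [blend, hi]
  · simp only [blend, hi, Pi.inf_apply, if_false, inf_of_le_left (hxz i hi)]

theorem blend_sup_blend {n : ℕ} {D : Finset (Fin n)} {x₀ z₀ : Fin n → Bool}
    (hxz : ∀ i ∉ D, x₀ i ≤ z₀ i) (x z : Fin n → Bool) :
    blend D x x₀ ⊔ blend D z z₀ = blend D (x ⊔ z) z₀ := by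
  funext i
  by_cases hi : i ∈ D
  · simp [blend, hi]
  · simp only [blend, hi, Pi.sup_apply, if_false, sup_of_le_right (hxz i hi)]

/-- The meet of minimizers for ordered boundary vectors minimizes for the lower one, and
their join minimizes for the upper one. -/
theorem Submodular.inf_sup_minimizers {n : ℕ} {P : (Fin n → Bool) → ℝ} (hP : Submodular P)
    {D : Finset (Fin n)} {x₀ z₀ : Fin n → Bool} (hxz : ∀ i ∉ D, x₀ i ≤ z₀ i)
    {x z : Fin n → Bool} (hx : ∀ u, P (blend D x x₀) ≤ P (blend D u x₀))
    (hz : ∀ u, P (blend D z z₀) ≤ P (blend D u z₀)) :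
    (∀ u, P (blend D (x ⊓ z) x₀) ≤ P (blend D u x₀)) ∧
      ∀ u, P (blend D (x ⊔ z) z₀) ≤ P (blend D u z₀) := by
  have h := hP (blend D x x₀) (blend D z z₀)
  rw [blend_inf_blend hxz, blend_sup_blend hxz] at h
  exact ⟨fun u => by linarith [hx u, hz (x ⊔ z)], fun u => by linarith [hz u, hx (x ⊓ z)]⟩

/-- Corollary (iv): for submodular `P` and boundary vectors
`x° ≤ z°` on `D^c`, the least elements of the two minimizer sets are ordered,
and so are the greatest elements: `x̲' ≤ z̲'` and `x̄' ≤ z̄'` (on `D`). -/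
theorem extremal_minimizers_monotone (n : ℕ) (P : (Fin n → Bool) → ℝ)
    (hP : Submodular P) (D : Finset (Fin n)) (x₀ z₀ : Fin n → Bool)
    (hxz : ∀ i ∉ D, x₀ i ≤ z₀ i)
    (xlo xhi zlo zhi : Fin n → Bool)
    (hxlo : (∀ x : Fin n → Bool, P (blend D xlo x₀) ≤ P (blend D x x₀)) ∧
      ∀ u : Fin n → Bool,
        (∀ x : Fin n → Bool, P (blend D u x₀) ≤ P (blend D x x₀)) →
        ∀ i ∈ D, xlo i ≤ u i)
    (hxhi : (∀ x : Fin n → Bool, P (blend D xhi x₀) ≤ P (blend D x x₀)) ∧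
      ∀ u : Fin n → Bool,
        (∀ x : Fin n → Bool, P (blend D u x₀) ≤ P (blend D x x₀)) →
        ∀ i ∈ D, u i ≤ xhi i)
    (hzlo : (∀ x : Fin n → Bool, P (blend D zlo z₀) ≤ P (blend D x z₀)) ∧
      ∀ u : Fin n → Bool,
        (∀ x : Fin n → Bool, P (blend D u z₀) ≤ P (blend D x z₀)) →
        ∀ i ∈ D, zlo i ≤ u i)
    (hzhi : (∀ x : Fin n → Bool, P (blend D zhi z₀) ≤ P (blend D x z₀)) ∧
      ∀ u : Fin n → Bool,
        (∀ x : Fin n → Bool, P (blend D u z₀) ≤ P (blend D x z₀)) →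
        ∀ i ∈ D, u i ≤ zhi i) :
    (∀ i ∈ D, xlo i ≤ zlo i) ∧ (∀ i ∈ D, xhi i ≤ zhi i) := by
  exact ⟨fun i hi =>
      (hxlo.2 _ (hP.inf_sup_minimizers hxz hxlo.1 hzlo.1).1 i hi).trans inf_le_right,
    fun i hi =>
      le_sup_left.trans (hzhi.2 _ (hP.inf_sup_minimizers hxz hxhi.1 hzhi.1).2 i hi)⟩
end

section
/- If a function P : {0,1}^n → ℝ is graph representable, then P is submodular. -/
/-- The cost of the s–t cut determined by labels `w` in a network on `N` usual
nodes with source/sink arc capacities `ds, dt` and internal arc capacities `d`: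
`p(w) = Σ_i d_{s,i}(1 − w_i) + Σ_i d_{i,t} w_i + Σ_{i,j} d_{i,j}(w_i − w_j) w_i`. -/
noncomputable def cutCost {N : ℕ} (ds dt : Fin N → ℝ) (d : Fin N → Fin N → ℝ)
    (w : Fin N → Bool) : ℝ :=
  (∑ i, ds i * (1 - ((w i).toNat : ℝ))) + (∑ i, dt i * ((w i).toNat : ℝ)) +
    ∑ i, ∑ j, d i j * (((w i).toNat : ℝ) - ((w j).toNat : ℝ)) * ((w i).toNat : ℝ)

/-- `V : {0,1}^n → ℝ` is graph representable if there are `N = n + m ≥ n` nodes,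
nonnegative capacities `ds, dt, d`, and a constant `c ≥ 0` such that
`V(x) = min_{z ∈ {0,1}^m} p(x, z) + c` for every `x`. -/
def GraphRepresentable {n : ℕ} (V : (Fin n → Bool) → ℝ) : Prop :=
  ∃ (m : ℕ) (ds dt : Fin (n + m) → ℝ) (d : Fin (n + m) → Fin (n + m) → ℝ) (c : ℝ),
    (∀ i, 0 ≤ ds i) ∧ (∀ i, 0 ≤ dt i) ∧ (∀ i j, 0 ≤ d i j) ∧ 0 ≤ c ∧
    ∀ x : Fin n → Bool,
      IsLeast { r : ℝ | ∃ z : Fin m → Bool,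
        r = cutCost ds dt d (Fin.append x z) + c } (V x)

/-- The cut cost is a submodular function of the labels. -/
theorem submodular_cutCost {N : ℕ} (ds dt : Fin N → ℝ) {d : Fin N → Fin N → ℝ}
    (hd : ∀ i j, 0 ≤ d i j) : Submodular (cutCost ds dt d) := by
  intro w v
  simp only [cutCost]
  have hs : ∑ i, ds i * (1 - (((w ⊓ v) i).toNat : ℝ)) + ∑ i, ds i * (1 - (((w ⊔ v) i).toNat : ℝ))
      = ∑ i, ds i * (1 - ((w i).toNat : ℝ)) + ∑ i, ds i * (1 - ((v i).toNat : ℝ)) := by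
    simp only [← Finset.sum_add_distrib, Pi.inf_apply, Pi.sup_apply]
    refine Finset.sum_congr rfl fun i _ => ?_
    cases w i <;> cases v i <;> simp
  have ht : ∑ i, dt i * (((w ⊓ v) i).toNat : ℝ) + ∑ i, dt i * (((w ⊔ v) i).toNat : ℝ)
      = ∑ i, dt i * ((w i).toNat : ℝ) + ∑ i, dt i * ((v i).toNat : ℝ) := by
    simp only [← Finset.sum_add_distrib, Pi.inf_apply, Pi.sup_apply]
    refine Finset.sum_congr rfl fun i _ => ?_
    cases w i <;> cases v i <;> simp
  have hq : (∑ i, ∑ j, d i j * ((((w ⊓ v) i).toNat : ℝ) - (((w ⊓ v) j).toNat : ℝ)) *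
        (((w ⊓ v) i).toNat : ℝ)) +
      (∑ i, ∑ j, d i j * ((((w ⊔ v) i).toNat : ℝ) - (((w ⊔ v) j).toNat : ℝ)) *
        (((w ⊔ v) i).toNat : ℝ))
      ≤ (∑ i, ∑ j, d i j * (((w i).toNat : ℝ) - ((w j).toNat : ℝ)) * ((w i).toNat : ℝ)) +
        ∑ i, ∑ j, d i j * (((v i).toNat : ℝ) - ((v j).toNat : ℝ)) * ((v i).toNat : ℝ) := by
    simp only [← Finset.sum_add_distrib, Pi.inf_apply, Pi.sup_apply]
    refine Finset.sum_le_sum fun i _ => Finset.sum_le_sum fun j _ => ?_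
    have := hd i j
    cases w i <;> cases v i <;> cases w j <;> cases v j <;> simp [this]
  linarith

theorem Fin.append_inf_append {α : Type*} [Min α] {n m : ℕ} (x y : Fin n → α) (z t : Fin m → α) :
    Fin.append x z ⊓ Fin.append y t = Fin.append (x ⊓ y) (z ⊓ t) := by
  ext i
  refine Fin.addCases (fun i => ?_) (fun i => ?_) i <;> simp

theorem Fin.append_sup_append {α : Type*} [Max α] {n m : ℕ} (x y : Fin n → α) (z t : Fin m → α) :
    Fin.append x z ⊔ Fin.append y t = Fin.append (x ⊔ y) (z ⊔ t) := by
  ext i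
  refine Fin.addCases (fun i => ?_) (fun i => ?_) i <;> simp

/-- Theorem 3: a graph representable function is submodular. -/
theorem graphRepresentable_submodular (n : ℕ) (P : (Fin n → Bool) → ℝ)
    (h : GraphRepresentable P) : Submodular P := by
  obtain ⟨m, ds, dt, d, c, -, -, hd, -, hP⟩ := h
  intro x y
  obtain ⟨z, hz⟩ := (hP x).1
  obtain ⟨t, ht⟩ := (hP y).1
  have hinf := (hP (x ⊓ y)).2 ⟨z ⊓ t, rfl⟩
  have hsup := (hP (x ⊔ y)).2 ⟨z ⊔ t, rfl⟩
  have hsub := submodular_cutCost ds dt hd (Fin.append x z) (Fin.append y t)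
  rw [Fin.append_inf_append, Fin.append_sup_append] at hsub
  linarith
end

section
/- Let m > 2 be odd, a > 0, l = (m−1)/2, and define b₁ = b₂ = … = b_{l−1} = 2a, b_l = a, e_j = −(2m − 4j + 1)a for j = 1,…,l−1, and e_l = −2a. Then for every x ∈ {0,1}^m, min_{z ∈ {0,1}^l} [ Σ_{j=1}^l b_j Σ_{i=1}^m (z_j − x_i) z_j + Σ_{j=1}^l e_j z_j ] = a·∏_{i=1}^m x_i − a·Σ_{1 ≤ i < j ≤ m} x_i x_j. -/
theorem sq_sum_eq_sum_sq_add_two_mul_sum_lt {ι : Type*} [Fintype ι] [LinearOrder ι]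
    (f : ι → ℝ) :
    (∑ i, f i) ^ 2 = ∑ i, f i ^ 2 +
      2 * ∑ p ∈ Finset.univ.filter (fun p : ι × ι => p.1 < p.2), f p.1 * f p.2 := by
  have hlt : ∑ p ∈ Finset.univ.filter (fun p : ι × ι => p.1 < p.2), f p.1 * f p.2 =
      ∑ i, ∑ j, if i < j then f i * f j else 0 := by
    rw [Finset.sum_filter, Fintype.sum_prod_type]
  have hgt : ∑ i, ∑ j, (if i < j then f i * f j else 0) =
      ∑ i, ∑ j, if j < i then f i * f j else 0 := by
    rw [Finset.sum_comm]
    simp only [mul_comm]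
  have hdiag : ∑ i, f i ^ 2 = ∑ i, ∑ j, if i = j then f i * f j else 0 := by
    simp [sq]
  rw [hlt, two_mul]
  nth_rewrite 2 [hgt]
  rw [hdiag, sq, Finset.sum_mul_sum]
  simp only [← Finset.sum_add_distrib]
  refine Finset.sum_congr rfl fun i _ => Finset.sum_congr rfl fun j _ => ?_
  rcases lt_trichotomy i j with h | h | h
  · simp [h, h.ne, h.not_gt]
  · simp [h]
  · simp [h, h.ne', h.not_gt]

theorem isLeast_sum_mul_toNat {ι : Type*} [Fintype ι] (c : ι → ℝ) :
    IsLeast {r : ℝ | ∃ z : ι → Bool, r = ∑ j, c j * ((z j).toNat : ℝ)}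
      (∑ j, min (c j) 0) := by
  constructor
  · refine ⟨fun j => decide (c j ≤ 0), Finset.sum_congr rfl fun j _ => ?_⟩
    by_cases h : c j ≤ 0
    · simp [h]
    · simp [h, (not_le.mp h).le]
  · rintro r ⟨z, rfl⟩
    refine Finset.sum_le_sum fun j _ => ?_
    cases z j <;> simp

theorem sum_range_min_of_le (k s : ℕ) (h : 2 * k ≤ s) :
    ∑ j ∈ Finset.range k, min (4 * (j : ℝ) + 3 - 2 * s) 0 = k * (2 * k + 1) - 2 * k * s := by
  induction k with
  | zero => simp
  | succ k ih =>
    have h' : (2 * ((k : ℝ) + 1)) ≤ s := by exact_mod_cast h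
    rw [Finset.sum_range_succ, ih (by omega), min_eq_left (by linarith)]
    push_cast
    ring

theorem sum_range_min_of_ge (k s : ℕ) (h : s ≤ 2 * k + 1) :
    ∑ j ∈ Finset.range k, min (4 * (j : ℝ) + 3 - 2 * s) 0 = -((s : ℝ) * (s - 1) / 2) := by
  induction k with
  | zero =>
    interval_cases s <;> simp
  | succ k ih =>
    by_cases hs : s ≤ 2 * k + 1
    · have h' : (s : ℝ) ≤ 2 * k + 1 := by exact_mod_cast hs
      rw [Finset.sum_range_succ, ih hs, min_eq_right (by linarith), add_zero]
    · rw [sum_range_min_of_le _ _ (by omega)]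
      obtain rfl | rfl : s = 2 * k + 2 ∨ s = 2 * k + 3 := by omega
      all_goals
        push_cast
        ring

theorem sum_range_min_add_min (k s : ℕ) (h : s ≤ 2 * k + 3) :
    ∑ j ∈ Finset.range k, min (4 * (j : ℝ) + 3 - 2 * s) 0 + min (2 * (k : ℝ) + 1 - s) 0 =
      (if s = 2 * k + 3 then 1 else 0) - (s : ℝ) * (s - 1) / 2 := by
  by_cases hs : s ≤ 2 * k + 1
  · have h' : (s : ℝ) ≤ 2 * k + 1 := by exact_mod_cast hs
    rw [sum_range_min_of_ge k s hs, min_eq_right (by linarith), if_neg (by omega)]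
    ring
  · have h' : 2 * (k : ℝ) + 1 ≤ s := by exact_mod_cast (not_le.mp hs).le
    rw [sum_range_min_of_le k s (by omega), min_eq_left (by linarith)]
    obtain rfl | rfl : s = 2 * k + 2 ∨ s = 2 * k + 3 := by omega
    · rw [if_neg (by omega)]
      push_cast
      ring
    · rw [if_pos rfl]
      push_cast
      ring

theorem prod_toNat_eq_ite {ι : Type*} [Fintype ι] (x : ι → Bool) :
    ∏ i, ((x i).toNat : ℝ) = if ∑ i, (x i).toNat = Fintype.card ι then 1 else 0 := by
  have hcard : Fintype.card ι = ∑ _i : ι, 1 := by simp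
  have hiff : ∑ i, (x i).toNat = Fintype.card ι ↔ ∀ i, x i = true := by
    rw [hcard, Finset.sum_eq_sum_iff_of_le fun i _ => Bool.toNat_le (x i)]
    simp
  by_cases hx : ∀ i, x i = true
  · rw [if_pos (hiff.mpr hx)]
    simp [hx]
  · rw [if_neg (mt hiff.mp hx)]
    push Not at hx
    obtain ⟨i, hi⟩ := hx
    exact Finset.prod_eq_zero (Finset.mem_univ i) (by simpa using hi)


/-- for odd `m > 2`, `a > 0`, `l = (m−1)/2`, with coefficients
`b₁ = … = b_{l−1} = 2a`, `b_l = a`, `e_j = −(2m − 4j + 1)a` for `j = 1,…,l−1`,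
`e_l = −2a` (here the Lean index `j : Fin l` represents the paper index `j+1`),
for every `x ∈ {0,1}^m`,
`min_{z ∈ {0,1}^l} [ Σ_j b_j Σ_i (z_j − x_i) z_j + Σ_j e_j z_j ]
  = a·∏_i x_i − a·Σ_{i<j} x_i x_j`. -/
theorem odd_case_min_formula (m : ℕ) (hm : 2 < m) (hodd : Odd m) (a : ℝ)
    (ha : 0 < a) (l : ℕ) (hl : l = (m - 1) / 2)
    (b e : Fin l → ℝ)
    (hb : ∀ j : Fin l, ((j : ℕ) + 1 < l → b j = 2 * a) ∧ ((j : ℕ) + 1 = l → b j = a))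
    (he : ∀ j : Fin l, ((j : ℕ) + 1 < l →
        e j = -(2 * (m : ℝ) - 4 * ((j : ℕ) + 1) + 1) * a) ∧
      ((j : ℕ) + 1 = l → e j = -2 * a)) :
    ∀ x : Fin m → Bool,
      IsLeast { r : ℝ | ∃ z : Fin l → Bool,
          r = (∑ j, b j * ∑ i, (((z j).toNat : ℝ) - ((x i).toNat : ℝ)) * ((z j).toNat : ℝ))
              + ∑ j, e j * ((z j).toNat : ℝ) }
        (a * ∏ i, ((x i).toNat : ℝ) -
          a * ∑ p ∈ Finset.univ.filter (fun p : Fin m × Fin m => p.1 < p.2),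
            ((x p.1).toNat : ℝ) * ((x p.2).toNat : ℝ)) := by
  intro x
  obtain ⟨k, rfl⟩ : ∃ k, m = 2 * k + 3 := by
    obtain ⟨n, rfl⟩ := hodd
    exact ⟨n - 1, by omega⟩
  obtain rfl : l = k + 1 := by omega
  set s := ∑ i, (x i).toNat with hs
  have hsle : s ≤ 2 * k + 3 := by
    simpa using Finset.sum_le_sum fun i (_ : i ∈ Finset.univ) => Bool.toNat_le (x i)
  have hpairs := sq_sum_eq_sum_sq_add_two_mul_sum_lt fun i => ((x i).toNat : ℝ)
  have hsq : ∀ i, ((x i).toNat : ℝ) ^ 2 = ((x i).toNat : ℝ) := fun i => by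
    cases x i <;> simp
  have hscast : ∑ i, ((x i).toNat : ℝ) = s := by
    rw [hs]
    push_cast
    rfl
  simp only [hsq, hscast] at hpairs
  have hobj : ∀ z : Fin (k + 1) → Bool,
      (∑ j, b j * ∑ i, (((z j).toNat : ℝ) - ((x i).toNat : ℝ)) * ((z j).toNat : ℝ))
        + ∑ j, e j * ((z j).toNat : ℝ) =
      ∑ j, (b j * ((2 * k + 3 : ℕ) - s) + e j) * ((z j).toNat : ℝ) := fun z => by
    rw [← Finset.sum_add_distrib]
    refine Finset.sum_congr rfl fun j _ => ?_
    cases z j <;> simp [hscast]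
  have hmin : ∑ j, min (b j * ((2 * k + 3 : ℕ) - s) + e j) 0 =
      a * (∑ j ∈ Finset.range k, min (4 * (j : ℝ) + 3 - 2 * s) 0
        + min (2 * (k : ℝ) + 1 - s) 0) := by
    rw [Fin.sum_univ_castSucc, mul_add, Finset.sum_range, Finset.mul_sum]
    congr 1
    · refine Finset.sum_congr rfl fun j _ => ?_
      have hj : ((Fin.castSucc j : Fin (k + 1)) : ℕ) + 1 < k + 1 := by simp
      rw [(hb _).1 hj, (he _).1 hj, mul_min_of_nonneg _ _ ha.le, mul_zero]
      congr 1
      push_cast [Fin.val_castSucc]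
      ring
    · have hj : ((Fin.last k : Fin (k + 1)) : ℕ) + 1 = k + 1 := by simp
      rw [(hb _).2 hj, (he _).2 hj, mul_min_of_nonneg _ _ ha.le, mul_zero]
      congr 1
      push_cast
      ring
  simp only [hobj]
  convert isLeast_sum_mul_toNat _ using 1
  rw [hmin, sum_range_min_add_min k s hsle, prod_toNat_eq_ite, Fintype.card_fin, ← hs]
  linear_combination (a / 2) * hpairs
end
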